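/- (Poncelet dichotomy for the John map.) Assume a > 0 and |b| > a + 1, so that C is nonempty and bounded. Then exactly one of the following holds: either there exists an integer N ≥ 1 such that T^N(p) = p for every point p ∈ C (all points of C are periodic with a common period), or T^n(p) ≠ p for every p ∈ C and every integer n ≥ 1 (no point of C is periodic). -/

import Mathlib

namespace John

/-- The biquadratic defining the curve. -/
def F (a b x y : ℝ) : ℝ := x ^ 2 * y ^ 2 + 1 + a * (x ^ 2 + y ^ 2) + 2 * b * x * y

/-- Half the discriminant root. -/
def w (a b x y : ℝ) : ℝ := (x ^ 2 + a) * y + b * x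

/-- Numerator of the invariant. -/
def nu (a b s r x y X Y : ℝ) : ℝ := a * (s - r) * x * X + w a b x y * w a b X Y

/-- Denominator of the invariant. -/
def de (s x X : ℝ) : ℝ := s * (x ^ 2 + X ^ 2) - 1 - x ^ 2 * X ^ 2

/-- First involution. -/
noncomputable def I1 (a b : ℝ) (q : ℝ × ℝ) : ℝ × ℝ := (q.1, -2 * b * q.1 / (q.1 ^ 2 + a) - q.2)

/-- Second involution. -/
noncomputable def I2 (a b : ℝ) (q : ℝ × ℝ) : ℝ × ℝ := (-2 * b * q.2 / (q.2 ^ 2 + a) - q.1, q.2)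

lemma F_symm (a b x y : ℝ) : F a b x y = F a b y x := by unfold F; ring

lemma w_sq {a b s r x y : ℝ} (hF : F a b x y = 0) (hb : b ^ 2 = (a + s) * (a + r))
    (hrs : r * s = 1) : w a b x y ^ 2 = a * (s - x ^ 2) * (x ^ 2 - r) := by
  unfold F at hF
  unfold w
  linear_combination (x ^ 2 + a) * hF + x ^ 2 * hb + (x ^ 2 + a) * hrs

lemma nu_swap {a b s r x y X Y : ℝ} (hF : F a b x y = 0) (hF' : F a b X Y = 0)
    (hb : b ^ 2 = (a + s) * (a + r)) (hrs : r * s = 1) :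
    nu a b s r x y X Y * de s y Y = nu a b s r y x Y X * de s x X := by
  unfold F at hF hF'
  unfold nu de w
  linear_combination (x*X^3*Y^2 - y*X^2*Y^3 + x*X^3*a + x*X^2*Y*b - x*X*Y^2*s + y*X^2*Y*s
      - y*X*Y^2*b - y*Y^3*a - x*X*a*s - x*Y*b*s + y*X*b*s + y*Y*a*s) * hF
    + (-x^2*y*X*b + x^2*y*Y*a + x^2*y*Y*s - x*y^2*X*a - x*y^2*X*s + x*y^2*Y*b - x*X*a*s
      + x*Y*b*s - y*X*b*s + y*Y*a*s - x*X + y*Y) * hF'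
    + (x^2*y*X^2*Y - x*y^2*X*Y^2 + x^2*y*Y*s - x*y^2*X*s - x*X*Y^2*s + y*X^2*Y*s
      - x*X + y*Y) * hb
    + (x^2*y*X^2*Y - x*y^2*X*Y^2 + 2*x^2*y*Y*a + x^2*y*Y*s - 2*x*y^2*X*a - x*y^2*X*s
      - 2*x*X*Y^2*a - x*X*Y^2*s + 2*y*X^2*Y*a + y*X^2*Y*s - x*X + y*Y) * hrs

lemma bounds {a b s r x y : ℝ} (ha : 0 < a) (hF : F a b x y = 0)
    (hb : b ^ 2 = (a + s) * (a + r)) (hrs : r * s = 1) (hlt : r < s) :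
    r ≤ x ^ 2 ∧ x ^ 2 ≤ s := by
  have h := w_sq hF hb hrs
  have h2 : 0 ≤ (s - x ^ 2) * (x ^ 2 - r) := by
    by_contra hc
    push Not at hc
    nlinarith [sq_nonneg (w a b x y), mul_neg_of_pos_of_neg ha hc]
  constructor
  · by_contra hc
    push Not at hc
    nlinarith [mul_pos (sub_pos.2 hc) (sub_pos.2 (hc.trans hlt))]
  · by_contra hc
    push Not at hc
    nlinarith [mul_pos (sub_pos.2 hc) (sub_pos.2 (hlt.trans hc))]

lemma de_pos {a b s r x y X Y : ℝ} (ha : 0 < a) (hF : F a b x y = 0) (hF' : F a b X Y = 0)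
    (hb : b ^ 2 = (a + s) * (a + r)) (hrs : r * s = 1) (hr : 0 < r) (hlt : r < s) :
    0 < de s x X := by
  obtain ⟨h1, h2⟩ := bounds ha hF hb hrs hlt
  obtain ⟨h3, h4⟩ := bounds ha hF' hb hrs hlt
  have hr1 : r < 1 := by nlinarith
  have h5 : (s - x ^ 2) * (s - X ^ 2) ≤ (s - r) * (s - r) :=
    mul_le_mul (by linarith) (by linarith) (by linarith) (by linarith)
  unfold de
  nlinarith

lemma x_ne {a b x y : ℝ} (ha : 0 < a) (hF : F a b x y = 0) : x ≠ 0 := by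
  rintro rfl
  unfold F at hF
  nlinarith [mul_nonneg ha.le (sq_nonneg y)]

/-- Points related to `(x, y)` with the same invariant have first coordinate a root of a
fixed nonzero quadratic. -/
lemma quad {a b s r x y X Y D : ℝ} (ha : 0 < a) (hF : F a b x y = 0) (hF' : F a b X Y = 0)
    (hb : b ^ 2 = (a + s) * (a + r)) (hrs : r * s = 1) (hr : 0 < r) (hlt : r < s)
    (hD : nu a b s r x y X Y = a * D * de s x X) :
    (D ^ 2 * s - D ^ 2 * x ^ 2 + x ^ 2 - r) * X ^ 2 + (-2 * D * (s - r) * x) * X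
      + (D ^ 2 * s * x ^ 2 - D ^ 2 + 1 - r * x ^ 2) = 0 := by
  have hd := de_pos ha hF hF' hb hrs hr hlt
  have e1 := w_sq hF hb hrs
  have e2 := w_sq hF' hb hrs
  have e3 : w a b x y * w a b X Y = a * D * de s x X - a * (s - r) * x * X := by
    unfold nu at hD; linarith
  have e4 : (a * D * de s x X - a * (s - r) * x * X) ^ 2 =
      (a * (s - x ^ 2) * (x ^ 2 - r)) * (a * (s - X ^ 2) * (X ^ 2 - r)) := by
    rw [← e3, ← e1, ← e2]; ring
  have e5 : a ^ 2 * de s x X * ((D ^ 2 * s - D ^ 2 * x ^ 2 + x ^ 2 - r) * X ^ 2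
      + (-2 * D * (s - r) * x) * X + (D ^ 2 * s * x ^ 2 - D ^ 2 + 1 - r * x ^ 2)) = 0 := by
    have hs : s = 1 / r := by field_simp; linarith
    subst hs
    unfold de at e4 ⊢
    field_simp at e4 ⊢
    linear_combination a ^ 2 * e4
  have : a ^ 2 * de s x X ≠ 0 := by positivity
  exact (mul_eq_zero.1 e5).resolve_left this

lemma quad_ne {s r x D : ℝ} (hx : x ≠ 0) (hrs : r * s = 1) (hr : 0 < r) (hlt : r < s) :
    (D ^ 2 * s - D ^ 2 * x ^ 2 + x ^ 2 - r) ≠ 0 ∨ (-2 * D * (s - r) * x) ≠ 0 ∨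
      (D ^ 2 * s * x ^ 2 - D ^ 2 + 1 - r * x ^ 2) ≠ 0 := by
  by_cases hD : D = 0
  · subst hD
    by_cases h : x ^ 2 = r
    · right; right
      rw [h]
      have hr1 : r < 1 := by nlinarith
      nlinarith
    · left
      intro h'
      apply h
      linarith
  · right; left
    have : s - r ≠ 0 := by linarith
    simp [hD, this, hx]

open Polynomial in
lemma root_set {A B C : ℝ} (h : A ≠ 0 ∨ B ≠ 0 ∨ C ≠ 0) :
    ∃ S : Finset ℝ, S.card ≤ 2 ∧ ∀ t, A * t ^ 2 + B * t + C = 0 → t ∈ S := by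
  classical
  set P : ℝ[X] := Polynomial.C A * X ^ 2 + Polynomial.C B * X + Polynomial.C C with hP
  have hP0 : P ≠ 0 := by
    intro h0
    have c0 : P.coeff 0 = 0 := by rw [h0]; simp
    have c1 : P.coeff 1 = 0 := by rw [h0]; simp
    have c2 : P.coeff 2 = 0 := by rw [h0]; simp
    simp [hP, coeff_X, coeff_C] at c0 c1 c2
    tauto
  refine ⟨P.roots.toFinset, ?_, ?_⟩
  · calc _ ≤ P.roots.card := Multiset.toFinset_card_le _
      _ ≤ P.natDegree := card_roots' _
      _ ≤ 2 := natDegree_quadratic_le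
  · intro t ht
    simp only [Multiset.mem_toFinset, mem_roots hP0, IsRoot.def]
    simpa [hP] using ht

lemma F_I1 {a b : ℝ} (ha : 0 < a) (q : ℝ × ℝ) :
    F a b (I1 a b q).1 (I1 a b q).2 = F a b q.1 q.2 := by
  have : q.1 ^ 2 + a ≠ 0 := by positivity
  unfold F I1
  field_simp
  ring

lemma w_I1 {a b : ℝ} (ha : 0 < a) (q : ℝ × ℝ) :
    w a b (I1 a b q).1 (I1 a b q).2 = - w a b q.1 q.2 := by
  have : q.1 ^ 2 + a ≠ 0 := by positivity
  unfold w I1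
  field_simp
  ring

lemma I2_eq (a b : ℝ) (q : ℝ × ℝ) : I2 a b q = (I1 a b q.swap).swap := rfl

lemma I1_invol (a b : ℝ) : Function.Involutive (I1 a b) := by
  intro q; unfold I1; simp

lemma I2_invol (a b : ℝ) : Function.Involutive (I2 a b) := by
  intro q; unfold I2; simp

/-- The relation: both points on the curve with invariant `D`. -/
def Rel (a b s r D : ℝ) (p q : ℝ × ℝ) : Prop :=
  F a b p.1 p.2 = 0 ∧ F a b q.1 q.2 = 0 ∧
    nu a b s r p.1 p.2 q.1 q.2 = a * D * de s p.1 q.1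

lemma Rel.i1 {a b s r D : ℝ} (ha : 0 < a) {p q : ℝ × ℝ} (h : Rel a b s r D p q) :
    Rel a b s r D (I1 a b p) (I1 a b q) := by
  obtain ⟨h1, h2, h3⟩ := h
  refine ⟨by rw [F_I1 ha, h1], by rw [F_I1 ha, h2], ?_⟩
  unfold nu at h3 ⊢
  rw [w_I1 ha, w_I1 ha, neg_mul_neg]
  exact h3

lemma Rel.swap {a b s r D : ℝ} (ha : 0 < a)
    (hb : b ^ 2 = (a + s) * (a + r)) (hrs : r * s = 1) (hr : 0 < r) (hlt : r < s)
    {p q : ℝ × ℝ} (h : Rel a b s r D p q) : Rel a b s r D p.swap q.swap := by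
  obtain ⟨h1, h2, h3⟩ := h
  refine ⟨by rw [← h1, F_symm]; rfl, by rw [← h2, F_symm]; rfl, ?_⟩
  have hd := de_pos ha h1 h2 hb hrs hr hlt
  have := nu_swap h1 h2 hb hrs
  rw [h3] at this
  apply mul_right_cancel₀ hd.ne'
  simp only [Prod.fst_swap, Prod.snd_swap]
  rw [← this]; ring

lemma Rel.step {a b s r D : ℝ} (ha : 0 < a)
    (hb : b ^ 2 = (a + s) * (a + r)) (hrs : r * s = 1) (hr : 0 < r) (hlt : r < s)
    {p q : ℝ × ℝ} (h : Rel a b s r D p q) :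
    Rel a b s r D ((I2 a b ∘ I1 a b) p) ((I2 a b ∘ I1 a b) q) := by
  simp only [Function.comp, I2_eq]
  exact (((h.i1 ha).swap ha hb hrs hr hlt).i1 ha).swap ha hb hrs hr hlt

lemma Rel.iter {a b s r D : ℝ} (ha : 0 < a)
    (hb : b ^ 2 = (a + s) * (a + r)) (hrs : r * s = 1) (hr : 0 < r) (hlt : r < s)
    {p q : ℝ × ℝ} (h : Rel a b s r D p q) (n : ℕ) :
    Rel a b s r D ((I2 a b ∘ I1 a b)^[n] p) ((I2 a b ∘ I1 a b)^[n] q) := by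
  induction n with
  | zero => exact h
  | succ k ih =>
    rw [Function.iterate_succ_apply', Function.iterate_succ_apply']
    exact ih.step ha hb hrs hr hlt

lemma exists_s {a b : ℝ} (ha : 0 < a) (hb : a + 1 < |b|) :
    ∃ s r : ℝ, b ^ 2 = (a + s) * (a + r) ∧ r * s = 1 ∧ 0 < r ∧ r < s := by
  have hb2 : (a + 1) ^ 2 < b ^ 2 := by
    rw [← sq_abs b]; nlinarith
  obtain ⟨d, hd⟩ : ∃ d, d = b ^ 2 - 1 - a ^ 2 := ⟨_, rfl⟩
  have hd2 : 2 * a < d := by nlinarith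
  have hpos : 0 < d ^ 2 - 4 * a ^ 2 := by nlinarith
  obtain ⟨e, he⟩ : ∃ e, e = Real.sqrt (d ^ 2 - 4 * a ^ 2) := ⟨_, rfl⟩
  have he2 : e ^ 2 = d ^ 2 - 4 * a ^ 2 := by rw [he]; exact Real.sq_sqrt hpos.le
  have he0 : 0 < e := by rw [he]; exact Real.sqrt_pos.2 hpos
  have hed : e < d := by nlinarith
  refine ⟨(d + e) / (2 * a), (d - e) / (2 * a), ?_, ?_, ?_, ?_⟩
  · field_simp
    nlinarith
  · field_simp
    nlinarith
  · apply div_pos <;> linarith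
  · gcongr; linarith

lemma exists_pt {a b : ℝ} (hb : a + 1 < |b|) : ∃ p : ℝ × ℝ, F a b p.1 p.2 = 0 := by
  obtain ⟨m, hm⟩ : ∃ m, m = |b| - a := ⟨_, rfl⟩
  have hm1 : 1 < m := by linarith
  have hpos : 0 < m ^ 2 - 1 := by nlinarith
  have h2 := Real.sq_sqrt hpos.le
  obtain ⟨e, he⟩ : ∃ e, e = Real.sqrt (m ^ 2 - 1) := ⟨_, rfl⟩
  rw [← he] at h2
  have he0 : 0 ≤ e := by rw [he]; positivity
  have hx := Real.sq_sqrt (show 0 ≤ m + e by linarith)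
  obtain ⟨x, hx'⟩ : ∃ x, x = Real.sqrt (m + e) := ⟨_, rfl⟩
  rw [← hx'] at hx
  have key : x ^ 4 + 1 - 2 * m * x ^ 2 = 0 := by
    have : x ^ 4 = (x ^ 2) ^ 2 := by ring
    rw [this, hx]; linear_combination h2
  rcases abs_cases b with ⟨h, _⟩ | ⟨h, _⟩
  · refine ⟨(x, -x), ?_⟩
    unfold F
    rw [hm, h] at key
    linear_combination key
  · refine ⟨(x, x), ?_⟩
    unfold F
    rw [hm, h] at key
    linear_combination key

lemma periodic {a b : ℝ} (ha : 0 < a) (hb : a + 1 < |b|) {p q : ℝ × ℝ}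
    (hp : F a b p.1 p.2 = 0) (hq : F a b q.1 q.2 = 0) {n : ℕ}
    (hn : (I2 a b ∘ I1 a b)^[n] p = p) : (I2 a b ∘ I1 a b)^[n * 12] q = q := by
  classical
  obtain ⟨s, r, hb2, hrs, hr, hlt⟩ := exists_s ha hb
  have hd := de_pos ha hp hq hb2 hrs hr hlt
  set T := I2 a b ∘ I1 a b with hT
  have hinj : Function.Injective T := (I2_invol a b).injective.comp (I1_invol a b).injective
  obtain ⟨D, hD⟩ : ∃ D, D = nu a b s r p.1 p.2 q.1 q.2 / (a * de s p.1 q.1) := ⟨_, rfl⟩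
  have h0 : Rel a b s r D p q := by
    refine ⟨hp, hq, ?_⟩
    rw [hD]; field_simp
  have hj : ∀ j : ℕ, Rel a b s r D p ((T^[n])^[j] q) := by
    intro j
    have h1 := h0.iter ha hb2 hrs hr hlt (n * j)
    rw [← hT, Function.iterate_mul,
      Function.iterate_fixed hn] at h1
    exact h1
  have hp' : F a b p.2 p.1 = 0 := by rw [F_symm]; exact hp
  obtain ⟨S1, hS1, hm1⟩ := root_set (quad_ne (D := D) (x_ne ha hp) hrs hr hlt)
  obtain ⟨S2, hS2, hm2⟩ := root_set (quad_ne (D := D) (x_ne ha hp') hrs hr hlt)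
  have hmem : ∀ j ∈ Finset.range 5, (T^[n])^[j] q ∈ S1 ×ˢ S2 := by
    intro j _
    have h1 := hj j
    have h2 := h1.swap ha hb2 hrs hr hlt
    rw [Finset.mem_product]
    exact ⟨hm1 _ (quad ha h1.1 h1.2.1 hb2 hrs hr hlt h1.2.2),
      hm2 _ (quad ha h2.1 h2.2.1 hb2 hrs hr hlt h2.2.2)⟩
  have hcard : (S1 ×ˢ S2).card < (Finset.range 5).card := by
    rw [Finset.card_product, Finset.card_range]
    nlinarith
  obtain ⟨i, hi, j, hj', hne, heq⟩ :=
    Finset.exists_ne_map_eq_of_card_lt_of_maps_to hcard hmem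
  have hinj' : Function.Injective T^[n] := hinj.iterate n
  have main : ∀ i j : ℕ, i < j → j < 5 → (T^[n])^[i] q = (T^[n])^[j] q →
      (T^[n])^[12] q = q := by
    intro i j hij hj5 h
    obtain ⟨k, rfl⟩ := Nat.exists_eq_add_of_lt hij
    rw [add_assoc, Function.iterate_add_apply] at h
    have h3 := (hinj'.iterate i) h
    have h4 : Function.IsPeriodicPt (T^[n]) (k + 1) q := h3.symm
    have h5 : k + 1 ∣ 12 := by
      have : k < 4 := by omega
      interval_cases k <;> decide
    exact h4.trans_dvd h5
  rw [Function.iterate_mul]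
  rw [Finset.mem_range] at hi hj'
  rcases lt_or_gt_of_ne hne with h | h
  · exact main i j h hj' heq
  · exact main j i h hi heq.symm

end John

/-- (Poncelet dichotomy for the John map.) Assume `a > 0` and `|b| > a + 1`,
so that `C` is nonempty and bounded. Then exactly one of the following holds:
either there exists `N ≥ 1` such that `T^[N] p = p` for every `p ∈ C` (all
points of `C` are periodic with a common period), or `T^[n] p ≠ p` for every
`p ∈ C` and every `n ≥ 1` (no point of `C` is periodic). -/
theorem poncelet_dichotomy (a b : ℝ) (ha : 0 < a) (hb : a + 1 < |b|) :
    Xor'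
      (∃ N : ℕ, 1 ≤ N ∧ ∀ p : ℝ × ℝ,
        p.1 ^ 2 * p.2 ^ 2 + 1 + a * (p.1 ^ 2 + p.2 ^ 2) + 2 * b * p.1 * p.2 = 0 →
        ((fun q : ℝ × ℝ => (-2 * b * q.2 / (q.2 ^ 2 + a) - q.1, q.2)) ∘
          (fun q : ℝ × ℝ => (q.1, -2 * b * q.1 / (q.1 ^ 2 + a) - q.2)))^[N] p = p)
      (∀ p : ℝ × ℝ,
        p.1 ^ 2 * p.2 ^ 2 + 1 + a * (p.1 ^ 2 + p.2 ^ 2) + 2 * b * p.1 * p.2 = 0 →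
        ∀ n : ℕ, 1 ≤ n →
        ((fun q : ℝ × ℝ => (-2 * b * q.2 / (q.2 ^ 2 + a) - q.1, q.2)) ∘
          (fun q : ℝ × ℝ => (q.1, -2 * b * q.1 / (q.1 ^ 2 + a) - q.2)))^[n] p ≠ p) := by
  by_cases h : ∃ p : ℝ × ℝ, John.F a b p.1 p.2 = 0 ∧
      ∃ n : ℕ, 1 ≤ n ∧ (John.I2 a b ∘ John.I1 a b)^[n] p = p
  · obtain ⟨p, hp, n, hn, hpn⟩ := h
    refine Or.inl ⟨⟨n * 12, by omega, ?_⟩, ?_⟩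
    · intro q hq
      exact John.periodic ha hb hp hq hpn
    · intro h'
      exact h' p hp n hn hpn
  · push Not at h
    refine Or.inr ⟨fun p hp n hn => h p hp n hn, ?_⟩
    rintro ⟨N, hN, hall⟩
    obtain ⟨p, hp⟩ := John.exists_pt (a := a) hb
    exact h p hp N hN (hall p hp)
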